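/- Let G be a finite group with cyclic Sylow p-subgroup P, with p coprime to |Z(G)|, and suppose C_G(g) = Z(G)·P for some (every) element g ∈ P of order p. Let φ be a complex irreducible character of G with φ|_{Z(G)} = ζ·Id for ζ ∈ Irr(Z(G)). Then either φ(1) < |P|, or φ is a constituent of the induced character (ζ × λ)^G from Z(G)×P for every λ ∈ Irr(P). -/

import Mathlib

open scoped Classical BigOperators

/-- The (normalized) inner product of two complex-valued functions on a finite group. -/
noncomputable def charInner (G : Type*) [Group G] [Fintype G] (φ ψ : G → ℂ) : ℂ :=
  (Fintype.card G : ℂ)⁻¹ * ∑ g : G, φ g * (starRingEnd ℂ) (ψ g)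

/-- `χ` is an irreducible complex character of `G`. -/
def IsIrrChar (G : Type) [Group G] (χ : G → ℂ) : Prop :=
  ∃ V : FDRep ℂ G, CategoryTheory.Simple V ∧ χ = V.character


lemma sum_free_orbits {Q α M : Type*} [Group Q] [Fintype Q] [MulAction Q α] [AddCommGroup M]
    (X : Finset α) (hX : ∀ u : Q, ∀ x ∈ X, u • x ∈ X)
    (hfree : ∀ u : Q, ∀ x ∈ X, u • x = x → u = 1) (T : α → M)
    (hT : ∀ x ∈ X, ∑ u : Q, T (u • x) = 0) : ∑ x ∈ X, T x = 0 := by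
  classical
  refine Finset.sum_cancels_of_partition_cancels (MulAction.orbitRel Q α) ?_
  intro x hx
  rw [← hT x hx]
  symm
  refine Finset.sum_bij (fun u _ => u • x) ?_ ?_ ?_ ?_
  · intro u _
    simp only [Finset.mem_filter]
    exact ⟨hX u x hx, MulAction.mem_orbit x u⟩
  · intro u _ u' _ h
    have : (u'⁻¹ * u) • x = x := by
      rw [mul_smul, h, inv_smul_smul]
    have := hfree _ x hx this
    exact (inv_mul_eq_one.mp this).symm
  · intro y hy
    simp only [Finset.mem_filter] at hy
    obtain ⟨u, hu⟩ := hy.2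
    exact ⟨u, Finset.mem_univ _, hu⟩
  · intro u _; rfl

/-- Every endomorphism commuting with `N` agrees with one commuting with `G`
modulo the augmentation part. -/
lemma transfer_congr {G k V : Type*} [Group G] [Fintype G] [Field k] [AddCommGroup V] [Module k V]
    (ρ : G →* Module.End k V) (P N : Subgroup G) (hPN : P ≤ N)
    (hfree : ∀ t : G, t ∉ N → ∀ u ∈ P, t⁻¹ * u * t ∈ N → u = 1)
    (hσ : ∑ u : P, ρ u = 0)
    (I : Submodule k V) (hI : ∀ u ∈ P, ∀ v, ρ u v - v ∈ I)
    (f : Module.End k V) (hf : ∀ n ∈ N, f * ρ n = ρ n * f) :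
    ∃ a : Module.End k V, (∀ g, a * ρ g = ρ g * a) ∧ ∀ v, f v - a v ∈ I := by
  have key : ∀ x y : G, (x : G ⧸ N) = y → ρ x * f * ρ x⁻¹ = ρ y * f * ρ y⁻¹ := by
    intro x y h
    rw [QuotientGroup.eq] at h
    have h1 := hf _ h
    have : y = x * (x⁻¹ * y) := by group
    calc ρ x * f * ρ x⁻¹ = ρ x * (f * ρ (x⁻¹ * y)) * ρ y⁻¹ := by
          simp only [mul_assoc, ← map_mul]; congr 3; group
      _ = _ := by
          rw [h1]; simp only [← mul_assoc, ← map_mul]; simp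
  set F : G ⧸ N → Module.End k V := fun c => ρ c.out * f * ρ c.out⁻¹ with hF
  have hFx : ∀ x : G, F (x : G ⧸ N) = ρ x * f * ρ x⁻¹ := by
    intro x
    exact key _ _ (by simp)
  have hFs : ∀ (g : G) (c : G ⧸ N), F (g • c) = ρ g * F c * ρ g⁻¹ := by
    intro g c
    induction c using QuotientGroup.induction_on with
    | H x =>
      change F ((g * x : G) : G ⧸ N) = _
      rw [hFx, hFx]
      simp [mul_assoc]
  refine ⟨∑ c, F c, ?_, ?_⟩
  · intro g
    have : ∑ c, F c = ∑ c, F (g • c) :=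
      (Equiv.sum_comp (MulAction.toPerm g : Equiv.Perm (G ⧸ N)) F).symm
    calc (∑ c, F c) * ρ g = (∑ c, F (g • c)) * ρ g := by rw [← this]
      _ = ρ g * ∑ c, F c := by
        simp_rw [hFs]
        rw [Finset.sum_mul, Finset.mul_sum]
        refine Finset.sum_congr rfl fun c _ => ?_
        rw [mul_assoc, ← map_mul]; simp
  · intro v
    have h1 : F ((1 : G) : G ⧸ N) = f := by rw [hFx]; simp
    have h2 : ∑ c, F c = f + ∑ c ∈ Finset.univ.erase ((1 : G) : G ⧸ N), F c := by
      rw [← h1]; exact (Finset.add_sum_erase _ _ (Finset.mem_univ _)).symm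
    rw [h2]
    simp only [LinearMap.add_apply, sub_add_cancel_left, neg_mem_iff, LinearMap.sum_apply]
    rw [← Submodule.Quotient.mk_eq_zero, ← Submodule.mkQ_apply, map_sum]
    refine sum_free_orbits (Q := P) _ ?_ ?_ _ ?_
    · intro u x hx
      simp only [Finset.mem_erase, Finset.mem_univ, and_true] at hx ⊢
      intro h
      apply hx
      have : x = u⁻¹ • ((1 : G) : G ⧸ N) := by rw [← h, inv_smul_smul]
      rw [this]
      change (((u⁻¹ : P) : G) * 1 : G) = ((1 : G) : G ⧸ N)
      rw [QuotientGroup.eq]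
      simpa using hPN u.2
    · intro u x hx h
      induction x using QuotientGroup.induction_on with
      | H t =>
        simp only [Finset.mem_erase, Finset.mem_univ, and_true] at hx
        have ht : t ∉ N := by
          intro h'; apply hx; rw [QuotientGroup.eq]; simpa using h'
        change (((u : G) * t : G) : G ⧸ N) = t at h
        have h := h.symm
        rw [QuotientGroup.eq] at h
        exact Subtype.ext (hfree t ht u u.2 (by simpa [mul_assoc] using h))
    · intro x hx
      have : ∀ u : P, I.mkQ (F (u • x) v) = I.mkQ (F x (ρ (u⁻¹ : P) v)) := by
        intro u
        have : u • x = (u : G) • x := rfl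
        rw [this, hFs]
        rw [Submodule.mkQ_apply, Submodule.mkQ_apply, Submodule.Quotient.eq]
        exact hI u u.2 _
      simp_rw [this]
      rw [← map_sum, ← map_sum]
      have h3 : ∑ u : P, ρ (u⁻¹ : P) v = (∑ u : P, ρ u) v := by
        rw [LinearMap.sum_apply]
        exact Equiv.sum_comp (Equiv.inv P) (fun u : P => ρ u v)
      rw [h3, hσ]; simp

lemma geom_sum_char_p {k A : Type*} [Field k] [Ring A] [Algebra k A] (p n : ℕ) [Fact p.Prime]
    [CharP k p] (x : A) : ∑ i ∈ Finset.range (p ^ n), x ^ i = (x - 1) ^ (p ^ n - 1) := by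
  have h : ∑ i ∈ Finset.range (p ^ n), (Polynomial.X : Polynomial k) ^ i
      = (Polynomial.X - 1) ^ (p ^ n - 1) := by
    have h0 : (Polynomial.X - 1 : Polynomial k) ≠ 0 := by
      have := Polynomial.X_sub_C_ne_zero (1 : k)
      simpa using this
    apply mul_right_cancel₀ h0
    rw [geom_sum_mul, ← pow_succ, Nat.sub_add_cancel (Nat.one_le_pow _ _ (Fact.out (p := p.Prime)).pos)]
    rw [sub_pow_char_pow, one_pow]
  have := congrArg (Polynomial.aeval x) h
  simpa using this

/-- A map congruent to `c + nilpotent` modulo `range y`. -/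
lemma nilp_of_congr {k V : Type*} [Field k] [AddCommGroup V] [Module k V]
    (y f a : Module.End k V) (hy : IsNilpotent y) (hfy : f * y = y * f)
    (hfa : ∀ v, f v - a v ∈ LinearMap.range y) (c : k)
    (ha : IsNilpotent (a - algebraMap k _ c)) : IsNilpotent (f - algebraMap k _ c) := by
  obtain ⟨m, hm⟩ := ha
  obtain ⟨r, hr⟩ := hy
  set b := f - algebraMap k (Module.End k V) c with hb
  set a' := a - algebraMap k (Module.End k V) c with ha'
  have hby : Commute b y := by
    have : Commute (algebraMap k (Module.End k V) c) y := Algebra.commutes _ _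
    exact (show Commute f y from hfy).sub_left this
  have h1 : ∀ j v, (b ^ j) v - (a' ^ j) v ∈ LinearMap.range y := by
    intro j
    induction j with
    | zero => intro v; simp
    | succ j ih =>
      intro v
      rw [pow_succ', pow_succ']
      have e : (b * b ^ j) v - (a' * a' ^ j) v
          = b ((b ^ j) v - (a' ^ j) v) + (f ((a' ^ j) v) - a ((a' ^ j) v)) := by
        simp [hb, ha', map_sub]; abel
      rw [e]
      refine add_mem ?_ (hfa _)
      obtain ⟨w, hw⟩ := ih v
      refine ⟨b w, ?_⟩
      rw [← hw]
      exact (LinearMap.congr_fun hby.eq w).symm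
  have h2 : ∀ v, (b ^ m) v ∈ LinearMap.range y := by
    intro v
    have := h1 m v
    rw [hm] at this; simpa using this
  have hcm : ∀ i, Commute (b ^ m) (y ^ i) := fun i => hby.pow_pow m i
  have h3 : ∀ j v, ((b ^ m) ^ j) v ∈ LinearMap.range (y ^ j) := by
    intro j
    induction j with
    | zero => intro v; simp
    | succ j ih =>
      intro v
      obtain ⟨w, hw⟩ := ih v
      obtain ⟨w', hw'⟩ := h2 w
      refine ⟨w', ?_⟩
      rw [pow_succ (b ^ m) j |>.trans (pow_mul_comm' _ _), Module.End.mul_apply, ← hw,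
        ← Module.End.mul_apply, (hcm j).eq, Module.End.mul_apply, ← hw', ← Module.End.mul_apply, ← pow_succ]
  refine ⟨m * r, ?_⟩
  ext v
  obtain ⟨w, hw⟩ := h3 r v
  rw [pow_mul, ← hw, hr]; simp

/-- Common eigenvectors span. -/
lemma span_eigen {k V ι : Type*} [Field k] [IsAlgClosed k] [AddCommGroup V] [Module k V]
    [FiniteDimensional k V] (f : ι → Module.End k V) (hc : ∀ i j, Commute (f i) (f j))
    (n : ℕ) (hn : (n : k) ≠ 0) (hf : ∀ i, f i ^ n = 1) :
    Submodule.span k {v : V | ∀ i, ∃ c : k, f i v = c • v} = ⊤ := by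
  have h := Module.End.iSup_iInf_maxGenEigenspace_eq_top_of_iSup_maxGenEigenspace_eq_top_of_commute
    f (fun i j _ => hc i j) (fun i => Module.End.iSup_maxGenEigenspace_eq_top _)
  have hss : ∀ i, (f i).IsFinitelySemisimple := by
    intro i
    rw [Module.End.isFinitelySemisimple_iff_isSemisimple]
    apply Module.End.isSemisimple_of_squarefree_aeval_eq_zero (p := Polynomial.X ^ n - 1)
    · exact ((Polynomial.separable_X_pow_sub_C (1:k) hn one_ne_zero).squarefree)
    · simp [hf]
  rw [eq_top_iff, ← h]
  refine iSup_le fun χ => ?_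
  intro v hv
  refine Submodule.subset_span ?_
  intro i
  refine ⟨χ i, ?_⟩
  have := (Submodule.mem_iInf _).mp hv i
  rw [(hss i).maxGenEigenspace_eq_eigenspace] at this
  exact Module.End.mem_eigenspace_iff.mp this

lemma modular_core {G k V : Type*} [Group G] [Fintype G] [Field k] [IsAlgClosed k]
    [AddCommGroup V] [Module k V] [FiniteDimensional k V] [Nontrivial V]
    (p n : ℕ) [Fact p.Prime] [CharP k p] (ρ : G →* Module.End k V)
    (P H N : Subgroup G) (x : G) (hx : P = Subgroup.zpowers x) (hcard : Nat.card P = p ^ n)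
    (hHc : ∀ a ∈ H, ∀ b ∈ H, a * b = b * a) (hHp : ¬ p ∣ Nat.card H)
    (hHP : ∀ h ∈ H, ∀ u ∈ P, h * u * h⁻¹ ∈ P)
    (hN : ∀ t ∈ N, ∃ u ∈ P, ∃ h ∈ H, t = u * h) (hPN : P ≤ N)
    (hfree : ∀ t : G, t ∉ N → ∀ u ∈ P, t⁻¹ * u * t ∈ N → u = 1)
    (hσ : ∑ u : P, ρ u = 0)
    (hloc : ∀ a : Module.End k V, (∀ g, a * ρ g = ρ g * a) →
      ∃ c : k, IsNilpotent (a - algebraMap k _ c)) :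
    Module.finrank k V < p ^ n := by
  have hq : 0 < p ^ n := pow_pos (Fact.out (p := p.Prime)).pos n
  have hox : orderOf x = p ^ n := by rw [← hcard, hx, Nat.card_zpowers]
  have hPx : ∀ u ∈ P, ∃ i : ℕ, u = x ^ i := by
    intro u hu
    rw [hx, mem_zpowers_iff_mem_range_orderOf] at hu
    obtain ⟨i, _, hi⟩ := Finset.mem_image.mp hu
    exact ⟨i, hi.symm⟩
  have hxP : ∀ i : ℕ, x ^ i ∈ P := fun i => hx ▸ ⟨(i : ℤ), by simp⟩
  set X := ρ x with hX
  set y := X - 1 with hy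
  have hX' : X = 1 + y := by rw [hy]; abel
  have hXpow : ∀ i : ℕ, ρ (x ^ i) = X ^ i := fun i => by rw [map_pow]
  have hyq : y ^ (p ^ n - 1) = 0 := by
    rw [hy, ← geom_sum_char_p (k := k) p n, ← hσ, ← hox]
    refine Finset.sum_bij (fun i _ => (⟨x ^ i, hxP i⟩ : P)) (by simp) ?_ ?_ ?_
    · intro i hi j hj h
      have := congrArg Subtype.val h
      exact pow_injOn_Iio_orderOf (by simpa using hi) (by simpa using hj) this
    · intro u _
      have hu : (u : G) ∈ Subgroup.zpowers x := hx.le u.2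
      rw [mem_zpowers_iff_mem_range_orderOf] at hu
      obtain ⟨i, hi, hi'⟩ := Finset.mem_image.mp hu
      exact ⟨i, hi, Subtype.ext hi'⟩
    · intro i _
      exact (hXpow i).symm
  have hynil : IsNilpotent y := ⟨_, hyq⟩
  set D := nilpotencyClass y with hD
  have hDq : D ≤ p ^ n - 1 := Nat.sInf_le hyq
  have hyD : y ^ D = 0 := pow_nilpotencyClass hynil
  have hDpos : 0 < D := pos_nilpotencyClass_iff.mpr hynil
  have hyD1 : y ^ (D - 1) ≠ 0 := pow_pred_nilpotencyClass hynil
  have hyge : ∀ j, D ≤ j → y ^ j = 0 := fun j hj => pow_eq_zero_of_le hj hyD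
  -- eigenvectors
  have hHk : ((Nat.card H : ℕ) : k) ≠ 0 := by
    rw [Ne, CharP.cast_eq_zero_iff k p]; exact hHp
  have hpow : ∀ h : H, ρ h ^ Nat.card H = 1 := by
    intro h
    rw [← map_pow]
    have : (h : G) ^ Nat.card H = 1 := by
      rw [← SubgroupClass.coe_pow, pow_card_eq_one']; rfl
    rw [this, map_one]
  have hcomm : ∀ a b : H, Commute (ρ a) (ρ b) := by
    intro a b
    change _ * _ = _ * _
    rw [← map_mul, ← map_mul, hHc a a.2 b b.2]
  obtain ⟨v, hv, hvy⟩ : ∃ v : V, (∀ h : H, ∃ c : k, ρ h v = c • v) ∧ (y ^ (D - 1)) v ≠ 0 := by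
    by_contra hcon
    push Not at hcon
    apply hyD1
    have h1 := span_eigen (fun h : H => ρ h) hcomm _ hHk hpow
    have h2 : Submodule.span k {v : V | ∀ h : H, ∃ c : k, ρ h v = c • v}
        ≤ LinearMap.ker (y ^ (D - 1)) := by
      rw [Submodule.span_le]
      intro v hv
      exact hcon v hv
    rw [h1] at h2
    exact LinearMap.ker_eq_top.mp (top_le_iff.mp h2)
  obtain ⟨ξ, hξ, hξv⟩ : ∃ ξ : Module.Dual k V, (∀ h : H, ∃ c : k, ξ ∘ₗ ρ h = c • ξ) ∧
      ξ ((y ^ (D - 1)) v) ≠ 0 := by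
    by_contra hcon
    push Not at hcon
    apply hvy
    have h1 := span_eigen (V := Module.Dual k V) (fun h : H => (ρ h).dualMap)
      (by
        intro a b
        have := (hcomm b a).eq
        ext f w
        simpa using congrArg f (LinearMap.congr_fun this w)) (Nat.card H) hHk
      (by
        intro h
        have h0 : ∀ j : ℕ, (ρ h).dualMap ^ j = (ρ h ^ j).dualMap := by
          intro j
          induction j with
          | zero => rfl
          | succ j ih =>
            rw [pow_succ, ih, pow_succ']; rfl
        rw [h0, hpow]; rfl)
    have h2 : Submodule.span k {ξ : Module.Dual k V | ∀ h : H, ∃ c : k, (ρ h).dualMap ξ = c • ξ}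
        ≤ LinearMap.ker (Module.Dual.eval k V ((y ^ (D - 1)) v)) := by
      rw [Submodule.span_le]
      intro ξ hξ
      exact hcon ξ hξ
    rw [h1] at h2
    rw [← Module.forall_dual_apply_eq_zero_iff k]
    intro f
    exact h2 (Submodule.mem_top : f ∈ ⊤)
  -- the two maps
  let Ψ : (Fin D → k) →ₗ[k] V := Fintype.linearCombination k (fun i : Fin D => (y ^ (i : ℕ)) v)
  let Θ : V →ₗ[k] (Fin D → k) := LinearMap.pi (fun j : Fin D => ξ ∘ₗ (y ^ (j : ℕ)))
  have hΨ : ∀ a, Ψ a = ∑ i : Fin D, a i • (y ^ (i : ℕ)) v := fun a => rfl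
  have hΘ : ∀ w j, Θ w j = ξ ((y ^ (j : ℕ)) w) := fun w j => rfl
  have hinj : Function.Injective (Θ ∘ₗ Ψ) := by
    rw [← LinearMap.ker_eq_bot, LinearMap.ker_eq_bot']
    intro a ha
    by_contra hne
    have hex : ∃ i : ℕ, ∃ hi : i < D, a ⟨i, hi⟩ ≠ 0 := by
      by_contra hcon
      push Not at hcon
      exact hne (funext fun i => hcon i i.2)
    obtain ⟨hi, hai⟩ := Nat.find_spec hex
    set i := Nat.find hex with hidef
    have hmin : ∀ l : Fin D, (l : ℕ) < i → a l = 0 := by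
      intro l hl
      have := Nat.find_min hex hl
      push Not at this
      exact this l.2
    have h1 := congrFun ha ⟨D - 1 - i, by omega⟩
    rw [LinearMap.comp_apply, hΘ, hΨ] at h1
    simp only [map_sum, map_smul, Pi.zero_apply] at h1
    rw [Finset.sum_eq_single ⟨i, hi⟩] at h1
    · rw [← Module.End.mul_apply, ← pow_add] at h1
      have : D - 1 - i + i = D - 1 := by omega
      simp only [this] at h1
      rw [smul_eq_mul] at h1
      exact (mul_ne_zero hai hξv) h1
    · intro l _ hl
      rcases lt_or_ge (l : ℕ) i with h | h
      · rw [hmin l h, zero_smul]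
      · have hne : (l : ℕ) ≠ i := fun h' => hl (Fin.ext h')
        rw [← Module.End.mul_apply, ← pow_add, hyge _ (by omega)]
        simp
    · simp
  let M : (Fin D → k) ≃ₗ[k] (Fin D → k) := LinearEquiv.ofInjectiveEndo _ hinj
  have hM : ∀ a, M a = Θ (Ψ a) := fun a => rfl
  let f : Module.End k V := Ψ ∘ₗ M.symm.toLinearMap ∘ₗ Θ
  have hfdef : ∀ w, f w = Ψ (M.symm (Θ w)) := fun w => rfl
  have hfΨ : ∀ a, f (Ψ a) = Ψ a := by
    intro a; rw [hfdef, ← hM, LinearEquiv.symm_apply_apply]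
  have hfid : IsIdempotentElem f := by
    ext w
    rw [Module.End.mul_apply, hfdef w, hfΨ]
  have hrange : LinearMap.range f = LinearMap.range Ψ := by
    apply le_antisymm
    · rintro _ ⟨w, rfl⟩; exact ⟨_, rfl⟩
    · rintro _ ⟨a, rfl⟩; exact ⟨Ψ a, hfΨ a⟩
  have hΘf : ∀ w, Θ (f w) = Θ w := by
    intro w; rw [hfdef, ← hM, LinearEquiv.apply_symm_apply]
  have hker : LinearMap.ker f = LinearMap.ker Θ := by
    ext w
    rw [LinearMap.mem_ker, LinearMap.mem_ker]
    constructor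
    · intro h; rw [← hΘf, h, map_zero]
    · intro h; rw [hfdef, h, map_zero, map_zero]
  -- description of the range
  have hrange' : LinearMap.range Ψ = Submodule.span k {w | ∃ u ∈ P, w = ρ u v} := by
    have hyv : ∀ j : ℕ, (y ^ j) v ∈ LinearMap.range Ψ := by
      intro j
      rcases lt_or_ge j D with h | h
      · refine ⟨Pi.single ⟨j, h⟩ 1, ?_⟩
        rw [hΨ, Finset.sum_eq_single ⟨j, h⟩]
        · simp
        · intro b _ hb; rw [Pi.single_eq_of_ne hb, zero_smul]
        · simp
      · rw [hyge j h]; exact zero_mem _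
    apply le_antisymm
    · rintro _ ⟨a, rfl⟩
      rw [hΨ]
      refine sum_mem fun i _ => Submodule.smul_mem _ _ ?_
      have hst : ∀ w ∈ Submodule.span k {w | ∃ u ∈ P, w = ρ u v},
          y w ∈ Submodule.span k {w | ∃ u ∈ P, w = ρ u v} := by
        intro w hw
        have : y w = X w - w := by rw [hy]; simp
        rw [this]
        refine sub_mem ?_ hw
        have hle : Submodule.span k {w | ∃ u ∈ P, w = ρ u v} ≤
            (Submodule.span k {w | ∃ u ∈ P, w = ρ u v}).comap X := by
          rw [Submodule.span_le]
          rintro _ ⟨u, hu, rfl⟩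
          refine Submodule.subset_span ⟨x * u, mul_mem (by simpa using hxP 1) hu, ?_⟩
          rw [map_mul]; rfl
        exact hle hw
      have : ∀ j : ℕ, (y ^ j) v ∈ Submodule.span k {w | ∃ u ∈ P, w = ρ u v} := by
        intro j
        induction j with
        | zero => exact Submodule.subset_span ⟨1, one_mem _, by simp⟩
        | succ j ih => rw [pow_succ']; exact hst _ ih
      exact this i
    · rw [Submodule.span_le]
      rintro _ ⟨u, hu, rfl⟩
      obtain ⟨i, rfl⟩ := hPx u hu
      rw [hXpow, hX', add_comm, (Commute.one_right y).add_pow]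
      simp only [one_pow, mul_one, LinearMap.sum_apply, SetLike.mem_coe]
      refine sum_mem fun m _ => ?_
      rw [← nsmul_eq_mul', LinearMap.smul_apply]
      exact nsmul_mem (hyv m) _
  have hker' : ∀ w, w ∈ LinearMap.ker Θ ↔ ∀ u ∈ P, ξ (ρ u w) = 0 := by
    intro w
    have hyall : w ∈ LinearMap.ker Θ ↔ ∀ j : ℕ, ξ ((y ^ j) w) = 0 := by
      rw [LinearMap.mem_ker]
      constructor
      · intro h j
        rcases lt_or_ge j D with hj | hj
        · exact congrFun h ⟨j, hj⟩
        · rw [hyge j hj]; simp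
      · intro h; ext j; exact h j
    rw [hyall]
    constructor
    · intro h u hu
      obtain ⟨i, rfl⟩ := hPx u hu
      rw [hXpow, hX', add_comm, (Commute.one_right y).add_pow]
      simp only [one_pow, mul_one, LinearMap.sum_apply, map_sum]
      refine Finset.sum_eq_zero fun m _ => ?_
      rw [← nsmul_eq_mul', LinearMap.smul_apply, map_nsmul, h, smul_zero]
    · intro h j
      have : ∀ j : ℕ, ∀ i : ℕ, ξ ((X ^ i) ((y ^ j) w)) = 0 := by
        intro j
        induction j with
        | zero => intro i; simpa [hXpow] using h _ (hxP i)
        | succ j ih =>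
          intro i
          have e : (y ^ (j + 1)) w = X ((y ^ j) w) - (y ^ j) w := by
            rw [pow_succ', Module.End.mul_apply]
            have hyw : ∀ w, y w = X w - w := fun w => by rw [hy]; simp
            exact hyw _
          rw [e, map_sub, map_sub, ih i, ← Module.End.mul_apply, ← pow_succ, ih (i + 1), sub_zero]
      simpa using this j 0
  have hfN : ∀ t ∈ N, f * ρ t = ρ t * f := by
    intro t ht
    have : Commute f (ρ t) := by
      rw [LinearMap.IsIdempotentElem.commute_iff hfid]
      obtain ⟨u, hu, h, hh, rfl⟩ := hN t ht
      constructor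
      · rw [hrange, hrange', Module.End.mem_invtSubmodule, Submodule.span_le]
        rintro _ ⟨u', hu', rfl⟩
        obtain ⟨c, hc⟩ := hv ⟨h, hh⟩
        have e : ρ (u * h) (ρ u' v) = c • ρ (u * (h * u' * h⁻¹)) v := by
          rw [← Module.End.mul_apply, ← map_mul]
          have : u * h * u' = (u * (h * u' * h⁻¹)) * h := by group
          rw [this, map_mul, Module.End.mul_apply, hc, map_smul]
        rw [SetLike.mem_coe, Submodule.mem_comap, e]
        exact Submodule.smul_mem _ _ (Submodule.subset_span
          ⟨_, mul_mem hu (hHP h hh u' hu'), rfl⟩)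
      · rw [hker, Module.End.mem_invtSubmodule]
        intro w hw
        rw [Submodule.mem_comap, hker']
        rw [hker'] at hw
        intro u' hu'
        obtain ⟨c, hc⟩ := hξ ⟨h, hh⟩
        have e : ρ u' (ρ (u * h) w) = ρ h (ρ (h⁻¹ * (u' * u) * h) w) := by
          rw [← Module.End.mul_apply, ← map_mul, ← Module.End.mul_apply, ← map_mul]
          congr 2; group
        rw [e]
        have := LinearMap.congr_fun hc (ρ (h⁻¹ * (u' * u) * h) w)
        rw [LinearMap.comp_apply] at this
        rw [this, LinearMap.smul_apply, hw, smul_zero]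
        have := hHP h⁻¹ (inv_mem hh) (u' * u) (mul_mem hu' hu)
        simpa using this
    exact this.eq
  have hI : ∀ u ∈ P, ∀ w, ρ u w - w ∈ LinearMap.range y := by
    intro u hu w
    obtain ⟨i, rfl⟩ := hPx u hu
    rw [hXpow]
    have := mul_geom_sum X i
    rw [← hy] at this
    exact ⟨(∑ j ∈ Finset.range i, X ^ j) w, by
      rw [← Module.End.mul_apply, this]; simp⟩
  obtain ⟨a, ha, hfa⟩ := transfer_congr ρ P N hPN hfree hσ (LinearMap.range y) hI f hfN
  obtain ⟨c, hc⟩ := hloc a ha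
  have hfX : f * X = X * f := hfN x (hPN (by simpa using hxP 1))
  have hfy : f * y = y * f := by rw [hy, mul_sub, sub_mul, hfX]; simp
  have hfc := nilp_of_congr y f a hynil hfy hfa c hc
  have hv0 : v ≠ 0 := by rintro rfl; simp at hvy
  have hvr : v ∈ LinearMap.range Ψ := by
    rw [hrange']; exact Submodule.subset_span ⟨1, one_mem _, by simp⟩
  have hfv : f v = v := by
    obtain ⟨b, hb⟩ := hvr
    rw [← hb, hfΨ]
  have hc0 : c ≠ 0 := by
    rintro rfl
    rw [map_zero, sub_zero] at hfc
    obtain ⟨m, hm⟩ := hfc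
    have : ∀ m : ℕ, (f ^ m) v = v := by
      intro m
      induction m with
      | zero => simp
      | succ m ih => rw [pow_succ, Module.End.mul_apply, hfv, ih]
    have h1 := this m
    rw [hm] at h1
    exact hv0 (by simpa using h1.symm)
  have hunit : IsUnit f := by
    have h1 : IsUnit (algebraMap k (Module.End k V) c) := (IsUnit.mk0 c hc0).map _
    have h2 := hfc.isUnit_add_right_of_commute h1 (Algebra.commutes _ _).symm
    simpa using h2
  have hf1 : f = 1 := by
    have := hfid.eq
    exact hunit.mul_left_cancel (by rw [this, mul_one])
  have hsurj : Function.Surjective Ψ := by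
    rw [← LinearMap.range_eq_top, ← hrange, hf1]
    exact LinearMap.range_id
  have := LinearMap.finrank_le_finrank_of_surjective hsurj
  rw [Module.finrank_fin_fun] at this
  omega

section GroupPart
variable {G : Type} [Group G] [Fintype G] (p : ℕ) [Fact p.Prime]

lemma coprime_eq_one {z : G} (m k : ℕ) (hmk : Nat.Coprime m k) (h1 : z ^ m = 1) (h2 : z ^ k = 1) :
    z = 1 := by
  have h3 := Nat.dvd_gcd (orderOf_dvd_of_pow_eq_one h1) (orderOf_dvd_of_pow_eq_one h2)
  rw [hmk] at h3
  exact orderOf_eq_one_iff.mp (Nat.dvd_one.mp h3)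

lemma mem_cent_decomp (P : Sylow p G)
    (g : G)
    (hcent : Subgroup.centralizer ({g} : Set G) = Subgroup.center G ⊔ (P : Subgroup G))
    {t : G} (ht : t * g = g * t) :
    ∃ z ∈ Subgroup.center G, ∃ u ∈ (P : Subgroup G), t = z * u := by
  have : t ∈ Subgroup.centralizer ({g} : Set G) := by
    rw [Subgroup.mem_centralizer_singleton_iff]; exact ht
  rw [hcent] at this
  obtain ⟨z, hz, u, hu, h⟩ := Subgroup.mem_sup_of_normal_left.mp this
  exact ⟨z, hz, u, hu, h.symm⟩

lemma center_coprime (hcop : ¬ p ∣ Fintype.card ↥(Subgroup.center G))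
    {z : G} (hz : z ∈ Subgroup.center G) (n : ℕ) (h : z ^ (p ^ n) = 1) : z = 1 := by
  refine coprime_eq_one (p ^ n) (Fintype.card (Subgroup.center G)) ?_ h ?_
  · exact Nat.Coprime.pow_left _ ((Nat.Prime.coprime_iff_not_dvd Fact.out).2 hcop)
  · have := pow_card_eq_one (x := (⟨z, hz⟩ : Subgroup.center G))
    exact congrArg Subtype.val this

lemma pelt_cent_mem (P : Sylow p G)
    (hcop : ¬ p ∣ Fintype.card ↥(Subgroup.center G))
    (g : G)
    (hcent : Subgroup.centralizer ({g} : Set G) = Subgroup.center G ⊔ (P : Subgroup G))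
    {t : G} (ht : t * g = g * t) (n : ℕ) (h : t ^ (p ^ n) = 1)
    (hP : ∀ u ∈ (P : Subgroup G), u ^ (p ^ n) = 1) : t ∈ (P : Subgroup G) := by
  obtain ⟨z, hz, u, hu, rfl⟩ := mem_cent_decomp p P g hcent ht
  have hc : Commute z u := (Subgroup.mem_center_iff.mp hz u).symm
  rw [hc.mul_pow, hP u hu, mul_one] at h
  rw [center_coprime p hcop hz n h, one_mul]
  exact hu

lemma ordp_mem_zpowers_aux (Q : Subgroup G) (hcyc : IsCyclic Q) (g : G) (hg : g ∈ Q)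
    (hgo : orderOf g = p) {t : G} (ht : t ∈ Q) (h : t ^ p = 1) :
    t ∈ Subgroup.zpowers g := by
  have hp : p.Prime := Fact.out
  have := hcyc
  have h1 := IsCyclic.card_pow_eq_one_le (α := Q) hp.pos
  set S := (Finset.univ.filter fun a : Q => a ^ p = 1) with hS
  set g' : Q := ⟨g, hg⟩
  have hg' : orderOf g' = p := by rw [← hgo]; exact (Subgroup.orderOf_coe g').symm
  set T := (Finset.univ.filter fun a : Q => a ∈ Subgroup.zpowers g') with hT
  have hTS : T ⊆ S := by
    intro a ha
    simp only [hT, hS, Finset.mem_filter, Finset.mem_univ, true_and] at ha ⊢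
    obtain ⟨i, rfl⟩ := Subgroup.mem_zpowers_iff.mp ha
    rw [← zpow_natCast, zpow_comm, zpow_natCast, ← hg', pow_orderOf_eq_one, one_zpow]
  have hTc : T.card = p := by
    rw [← hg', ← Fintype.card_zpowers, Fintype.card_subtype]
  have := Finset.eq_of_subset_of_card_le hTS (by rw [hTc]; exact h1)
  have h2 : (⟨t, ht⟩ : Q) ∈ T := by
    rw [this, hS]; simp [Subtype.ext_iff, h]
  simp only [hT, Finset.mem_filter, Finset.mem_univ, true_and] at h2
  obtain ⟨i, hi⟩ := Subgroup.mem_zpowers_iff.mp h2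
  refine Subgroup.mem_zpowers_iff.mpr ⟨i, ?_⟩
  simpa [Subtype.ext_iff, g'] using hi

lemma ordp_mem_zpowers (P : Sylow p G)
    (hcyc : IsCyclic ↥(P : Subgroup G))
    (g : G)
    (hg : g ∈ (P : Subgroup G))
    (hgo : orderOf g = p)
    {t : G} (ht : t ∈ (P : Subgroup G)) (h : t ^ p = 1) :
    t ∈ Subgroup.zpowers g := ordp_mem_zpowers_aux p P hcyc g hg hgo ht h

lemma g_mem_zpowers (P : Sylow p G)
    (hcyc : IsCyclic ↥(P : Subgroup G)) (g : G) (hg : g ∈ (P : Subgroup G)) (hgo : orderOf g = p)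
    {u : G} (hu : u ∈ (P : Subgroup G)) (hu1 : u ≠ 1) (n : ℕ)
    (hP : ∀ u ∈ (P : Subgroup G), u ^ (p ^ n) = 1) : g ∈ Subgroup.zpowers u := by
  have hp : p.Prime := Fact.out
  have hd := orderOf_dvd_of_pow_eq_one (hP u hu)
  obtain ⟨m, hm, hom⟩ := (Nat.dvd_prime_pow hp).mp hd
  obtain _ | m := m
  · exact absurd (orderOf_eq_one_iff.mp (by simpa using hom)) hu1
  set t := u ^ (p ^ m) with ht
  have hto : orderOf t = p := by
    rw [ht, orderOf_pow' _ (pow_ne_zero _ hp.ne_zero), hom, Nat.gcd_eq_right (pow_dvd_pow _ (Nat.le_succ m)),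
      pow_succ, Nat.mul_div_cancel_left _ (pow_pos hp.pos _)]
  have htP : t ∈ (P : Subgroup G) := pow_mem hu _
  have := ordp_mem_zpowers p P hcyc t htP hto hg (by rw [← hgo]; exact pow_orderOf_eq_one g)
  exact (Subgroup.zpowers_le.mpr (Subgroup.npow_mem_zpowers u _)) this

lemma free_aux (P : Sylow p G)
    (hcyc : IsCyclic ↥(P : Subgroup G))
    (hcop : ¬ p ∣ Fintype.card ↥(Subgroup.center G))
    (g : G)
    (hg : g ∈ (P : Subgroup G))
    (hgo : orderOf g = p)
    (hcent : Subgroup.centralizer ({g} : Set G) = Subgroup.center G ⊔ (P : Subgroup G))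
    (n : ℕ)
    (hP : ∀ u ∈ (P : Subgroup G), u ^ (p ^ n) = 1) (t : G)
    (ht : t ∉ Subgroup.normalizer ((P : Subgroup G) : Set G)) (u : G) (hu : u ∈ (P : Subgroup G))
    (hw : t⁻¹ * u * t ∈ Subgroup.normalizer ((P : Subgroup G) : Set G)) : u = 1 := by
  have hp : p.Prime := Fact.out
  by_contra hu1
  apply ht
  have conjpow : ∀ (a : G) (i : ℤ), (t⁻¹ * a * t) ^ i = t⁻¹ * a ^ i * t := by
    intro a i
    have := conj_zpow (i := i) (a := t⁻¹) (b := a)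
    simpa using this
  have conjpown : ∀ (a : G) (i : ℕ), (t⁻¹ * a * t) ^ i = t⁻¹ * a ^ i * t := by
    intro a i
    have := conj_pow (i := i) (a := t⁻¹) (b := a)
    simpa using this
  have hwP : t⁻¹ * u * t ∈ (P : Subgroup G) := by
    have hpg : IsPGroup p (Subgroup.zpowers (t⁻¹ * u * t)) := by
      rintro ⟨a, ha⟩
      obtain ⟨i, rfl⟩ := Subgroup.mem_zpowers_iff.mp ha
      refine ⟨n, ?_⟩
      ext
      push_cast
      rw [← zpow_natCast, zpow_comm, zpow_natCast, conjpown, hP u hu]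
      simp
    have h := hpg.inf_normalizer_sylow P
    have : t⁻¹ * u * t ∈ Subgroup.zpowers (t⁻¹ * u * t) ⊓ Subgroup.normalizer ((P : Subgroup G) : Set G) :=
      ⟨Subgroup.mem_zpowers _, hw⟩
    have h' : t⁻¹ * u * t ∈ Subgroup.zpowers (t⁻¹ * u * t) ⊓ (P : Subgroup G) := h ▸ this
    exact h'.2
  obtain ⟨a, ha⟩ := Subgroup.mem_zpowers_iff.mp (g_mem_zpowers p P hcyc g hg hgo hu hu1 n hP)
  have hgt : t⁻¹ * g * t ∈ (P : Subgroup G) := by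
    rw [← ha, ← conjpow]; exact zpow_mem hwP _
  have hgto : orderOf (t⁻¹ * g * t) = p := by
    rw [← hgo]
    have := orderOf_injective (MulAut.conj t⁻¹).toMonoidHom (MulAut.conj t⁻¹).injective g
    simpa using this
  have hgz : g ∈ Subgroup.zpowers (t⁻¹ * g * t) :=
    ordp_mem_zpowers p P hcyc _ hgt hgto hg (by rw [← hgo]; exact pow_orderOf_eq_one g)
  obtain ⟨j, hj⟩ := Subgroup.mem_zpowers_iff.mp hgz
  haveI := hcyc
  have hcomm : ∀ a ∈ (P : Subgroup G), ∀ b ∈ (P : Subgroup G), a * b = b * a := by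
    intro a ha b hb
    have := (IsCyclic.commGroup (α := (P : Subgroup G))).mul_comm ⟨a, ha⟩ ⟨b, hb⟩
    exact congrArg Subtype.val this
  have key : ∀ u' ∈ (P : Subgroup G), t⁻¹ * u' * t ∈ (P : Subgroup G) := by
    intro u' hu'
    refine pelt_cent_mem p P hcop g hcent ?_ n ?_ hP
    · have h1 : Commute u' (g ^ j) := (show Commute u' g from hcomm _ hu' _ hg).zpow_right j
      rw [conjpow] at hj
      have h2 := h1.eq
      rw [← hj]
      calc t⁻¹ * u' * t * (t⁻¹ * g ^ j * t) = t⁻¹ * (u' * g ^ j) * t := by group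
        _ = t⁻¹ * (g ^ j * u') * t := by rw [h2]
        _ = _ := by group
    · rw [conjpown, hP u' hu']; simp
  have hinj : Function.Injective (fun u' : (P : Subgroup G) =>
      (⟨t⁻¹ * u' * t, key u' u'.2⟩ : (P : Subgroup G))) := by
    intro a b hab
    have := congrArg Subtype.val hab
    simp only [mul_left_inj, mul_right_inj] at this
    exact Subtype.ext this
  have hsurj := Finite.injective_iff_surjective.mp hinj
  rw [Subgroup.mem_normalizer_iff'']
  intro b
  refine ⟨fun hb => key b hb, fun hb => ?_⟩
  obtain ⟨⟨u', hu'⟩, h⟩ := hsurj ⟨_, hb⟩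
  have := congrArg Subtype.val h
  simp only [mul_left_inj, mul_right_inj] at this
  exact this ▸ hu'

lemma group_data (P : Sylow p G)
    (hcyc : IsCyclic ↥(P : Subgroup G))
    (hcop : ¬ p ∣ Fintype.card ↥(Subgroup.center G))
    (g : G)
    (hg : g ∈ (P : Subgroup G))
    (hgo : orderOf g = p)
    (hcent : Subgroup.centralizer ({g} : Set G) = Subgroup.center G ⊔ (P : Subgroup G))
    : ∃ (n : ℕ) (x : G) (H N : Subgroup G), (P : Subgroup G) = Subgroup.zpowers x ∧
    Nat.card (P : Subgroup G) = p ^ n ∧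
    (∀ a ∈ H, ∀ b ∈ H, a * b = b * a) ∧ (¬ p ∣ Nat.card H) ∧
    (∀ h ∈ H, ∀ u ∈ (P : Subgroup G), h * u * h⁻¹ ∈ (P : Subgroup G)) ∧
    (∀ t ∈ N, ∃ u ∈ (P : Subgroup G), ∃ h ∈ H, t = u * h) ∧ ((P : Subgroup G) ≤ N) ∧
    (∀ t : G, t ∉ N → ∀ u ∈ (P : Subgroup G), t⁻¹ * u * t ∈ N → u = 1) := by
  have hp : p.Prime := Fact.out
  obtain ⟨n, hn⟩ := P.2.exists_card_eq
  change Nat.card (P : Subgroup G) = p ^ n at hn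
  have hP : ∀ u ∈ (P : Subgroup G), u ^ (p ^ n) = 1 := by
    intro u hu
    have := pow_card_eq_one' (x := (⟨u, hu⟩ : (P : Subgroup G)))
    rw [hn] at this
    exact congrArg Subtype.val this
  obtain ⟨x, hx⟩ := (Subgroup.isCyclic_iff_exists_zpowers_eq_top (P : Subgroup G)).mp hcyc
  set N := Subgroup.normalizer ((P : Subgroup G) : Set G) with hN
  have hPN : (P : Subgroup G) ≤ N := Subgroup.le_normalizer
  set P' := (P : Subgroup G).subgroupOf N with hP'
  have hnormal : P'.Normal := Subgroup.normal_in_normalizer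
  have hcard' : Nat.card P' = p ^ n := by
    rw [← hn]; exact Nat.card_congr (Subgroup.subgroupOfEquivOfLe hPN).toEquiv
  have hidx : ¬ p ∣ P'.index := by
    intro h
    have h1 : P'.index ∣ (P : Subgroup G).index := Subgroup.relIndex_dvd_index_of_le hPN
    exact P.not_dvd_index (h.trans h1)
  obtain ⟨K, hK⟩ := Subgroup.exists_right_complement'_of_coprime (N := P') (by
    rw [hcard']
    exact Nat.Coprime.pow_left _ ((Nat.Prime.coprime_iff_not_dvd hp).2 hidx))
  set H := K.map N.subtype with hH
  have hHN : H ≤ N := Subgroup.map_subtype_le K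
  have hKc : ¬ p ∣ Nat.card H := by
    have h1 : Nat.card H = Nat.card K :=
      (Nat.card_congr (K.equivMapOfInjective N.subtype N.subtype_injective).toEquiv).symm
    have h2 : Nat.card K = P'.index := hK.symm.index_eq_card.symm
    rw [h1, h2]; exact hidx
  refine ⟨n, x, H, N, hx.symm, hn, ?_, hKc, ?_, ?_, hPN, ?_⟩
  · -- commutativity
    have hHp1 : ∀ h ∈ H, ∀ m, h ^ (p ^ m) = 1 → h = 1 := by
      intro h hh m hm
      refine coprime_eq_one (p ^ m) (Nat.card H)
        (Nat.Coprime.pow_left _ ((Nat.Prime.coprime_iff_not_dvd hp).2 hKc)) hm ?_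
      exact congrArg Subtype.val (pow_card_eq_one' (x := (⟨h, hh⟩ : H)))
    have hNz : ∀ h ∈ N, h * g * h⁻¹ ∈ Subgroup.zpowers g := by
      intro h hh
      refine ordp_mem_zpowers p P hcyc g hg hgo ?_ ?_
      · exact (Subgroup.mem_normalizer_iff.mp hh g).mp hg
      · rw [conj_pow, ← hgo, pow_orderOf_eq_one]; simp
    have hHz : H ≤ Subgroup.normalizer ((Subgroup.zpowers g : Subgroup G) : Set G) := by
      intro h hh
      have hsub : ∀ h ∈ N, ∀ b ∈ Subgroup.zpowers g, h * b * h⁻¹ ∈ Subgroup.zpowers g := by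
        intro h hh b hb
        obtain ⟨i, rfl⟩ := Subgroup.mem_zpowers_iff.mp hb
        rw [← conj_zpow]
        exact zpow_mem (hNz h hh) i
      rw [Subgroup.mem_normalizer_iff]
      intro b
      refine ⟨hsub h (hHN hh) b, fun hb => ?_⟩
      have := hsub h⁻¹ (inv_mem (hHN hh)) _ hb
      simpa [mul_assoc] using this
    set f0 : H →* MulAut (Subgroup.zpowers g) :=
      (Subgroup.normalizerMonoidHom (Subgroup.zpowers g)).comp (Subgroup.inclusion hHz)
    have hcz : Nat.card (Subgroup.zpowers g) = p := by rw [Nat.card_zpowers, hgo]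
    have : Fact (Nat.card (Subgroup.zpowers g)).Prime := ⟨by rw [hcz]; exact hp⟩
    set f : H →* (ZMod (Nat.card (Subgroup.zpowers g)))ˣ :=
      (IsCyclic.mulAutMulEquiv (Subgroup.zpowers g)).toMonoidHom.comp f0
    have hker : f.ker ≤ Subgroup.center H := by
      intro h hh
      have h1 : f0 h = 1 := by
        have : (IsCyclic.mulAutMulEquiv (Subgroup.zpowers g)) (f0 h) = 1 := hh
        exact (MulEquiv.map_eq_one_iff _).mp this
      have h2 : (h : G) * g * (h : G)⁻¹ = g := by
        have h3 := congrArg Subtype.val (DFunLike.congr_fun h1 ⟨g, Subgroup.mem_zpowers g⟩)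
        simpa [f0] using h3
      have h4 : (h : G) * g = g * h := mul_inv_eq_iff_eq_mul.mp h2
      obtain ⟨z, hz, u, hu, hzu⟩ := mem_cent_decomp p P g hcent h4
      have hc : Commute z u := (Subgroup.mem_center_iff.mp hz u).symm
      have hpw : (h : G) ^ (p ^ n) ∈ Subgroup.center G := by
        rw [hzu, hc.mul_pow, hP u hu, mul_one]; exact pow_mem hz _
      -- a power of `h` prime to its order is central, so `h` is central
      have hcop2 : Nat.Coprime (orderOf (h : G)) (p ^ n) := by
        refine Nat.Coprime.pow_right _ (Nat.Coprime.symm ((Nat.Prime.coprime_iff_not_dvd hp).2 ?_))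
        intro hd
        refine hKc (hd.trans ?_)
        rw [Subgroup.orderOf_coe]
        exact orderOf_dvd_natCard h
      obtain ⟨m, hm⟩ := exists_pow_eq_self_of_coprime hcop2.symm
      have hcen : (h : G) ∈ Subgroup.center G := by rw [← hm]; exact pow_mem hpw m
      rw [Subgroup.mem_center_iff]
      intro b
      exact Subtype.ext (Subgroup.mem_center_iff.mp hcen b)
    intro a ha b hb
    exact congrArg Subtype.val (commutative_of_cyclic_center_quotient f hker ⟨a, ha⟩ ⟨b, hb⟩)
  · intro h hh u hu
    exact (Subgroup.mem_normalizer_iff.mp (hHN hh) u).mp hu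
  · intro t ht
    obtain ⟨⟨u, h⟩, huh⟩ := hK.2 (⟨t, ht⟩ : N)
    refine ⟨(u : N), Subgroup.mem_subgroupOf.mp u.2, (h : N), ⟨h, h.2, rfl⟩, ?_⟩
    exact (congrArg Subtype.val huh).symm
  · intro t ht u hu hw
    exact free_aux p P hcyc hcop g hg hgo hcent n hP t ht u hu hw

end GroupPart

open Polynomial in
lemma monic_splits_int {O K : Type*} [CommRing O] [IsDomain O] [IsIntegrallyClosed O] [Field K]
    [Algebra O K] [IsFractionRing O K] [IsAlgClosed K] (f : O[X]) (hf : f.Monic) :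
    ∃ s : Multiset O, f = (s.map (fun a => X - C a)).prod := by
  have hinj : Function.Injective (algebraMap O K) := IsFractionRing.injective O K
  have hsp := IsAlgClosed.splits (f.map (algebraMap O K))
  have hm : (f.map (algebraMap O K)).Monic := hf.map _
  have h1 := hsp.eq_prod_roots_of_monic hm
  have h2 : ∀ a ∈ (f.map (algebraMap O K)).roots, ∃ b : O, algebraMap O K b = a := by
    intro a ha
    have hr := (mem_roots hm.ne_zero).mp ha
    have : IsIntegral O a := ⟨f, hf, by rwa [IsRoot.def, eval_map] at hr⟩
    exact IsIntegrallyClosed.isIntegral_iff.mp this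
  have hlift : ∀ t : Multiset K, (∀ a ∈ t, ∃ b : O, algebraMap O K b = a) →
      ∃ s : Multiset O, s.map (algebraMap O K) = t := by
    intro t
    induction t using Multiset.induction with
    | empty => intro _; exact ⟨0, rfl⟩
    | cons a t ih =>
      intro h
      obtain ⟨b, rfl⟩ := h a (Multiset.mem_cons_self _ _)
      obtain ⟨s, rfl⟩ := ih fun c hc => h c (Multiset.mem_cons_of_mem hc)
      exact ⟨b ::ₘ s, by simp⟩
  obtain ⟨s, hs⟩ := hlift _ h2
  refine ⟨s, map_injective _ hinj ?_⟩
  rw [h1, ← hs]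
  simp [Polynomial.map_multiset_prod, Multiset.map_map]

open Polynomial in
lemma residue_algClosed {O K : Type*} [CommRing O] [IsDomain O] [IsLocalRing O]
    [IsIntegrallyClosed O] [Field K]
    [Algebra O K] [IsFractionRing O K] [IsAlgClosed K] : IsAlgClosed (IsLocalRing.ResidueField O) := by
  apply IsAlgClosed.of_exists_root
  intro q hq hirr
  obtain ⟨f, hf, hd, hm⟩ := lifts_and_natDegree_eq_and_monic (f := IsLocalRing.residue O) (p := q)
    ((mem_lifts _).mpr (Polynomial.map_surjective _ IsLocalRing.residue_surjective q)) hq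
  obtain ⟨s, hs⟩ := monic_splits_int (K := K) f hm
  have hs0 : s ≠ 0 := by
    rintro rfl
    simp only [Multiset.map_zero, Multiset.prod_zero] at hs
    rw [hs] at hf
    simp only [Polynomial.map_one] at hf
    exact hirr.not_isUnit (hf ▸ isUnit_one)
  obtain ⟨a, ha⟩ := Multiset.exists_mem_of_ne_zero hs0
  refine ⟨IsLocalRing.residue O a, ?_⟩
  rw [← hf, eval_map, eval₂_hom]
  have : f.eval a = 0 := by
    rw [hs, eval_multiset_prod]
    apply Multiset.prod_eq_zero
    rw [Multiset.map_map]
    exact Multiset.mem_map.mpr ⟨a, ha, by simp⟩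
  rw [this, map_zero]

open Polynomial in
lemma coprime_aux {O : Type*} [CommRing O] (s t : Multiset O)
    (h : ∀ a ∈ s, ∀ b ∈ t, IsUnit (a - b)) :
    IsCoprime (s.map (fun a => X - C a)).prod (t.map (fun a => X - C a)).prod := by
  have key : ∀ (x : O[X]) (t : Multiset O), (∀ b ∈ t, IsCoprime x (X - C b)) →
      IsCoprime x (t.map (fun a => X - C a)).prod := by
    intro x t
    induction t using Multiset.induction with
    | empty => intro _; simpa using isCoprime_one_right
    | cons b t ih =>
      intro hb
      rw [Multiset.map_cons, Multiset.prod_cons]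
      exact (hb b (Multiset.mem_cons_self _ _)).mul_right
        (ih fun c hc => hb c (Multiset.mem_cons_of_mem hc))
  refine key _ _ fun b hb => (key _ _ fun a ha => ?_).symm
  have := isCoprime_X_sub_C_of_isUnit_sub (h a ha b hb)
  exact this.symm

open Polynomial in
lemma local_of_min {O K B : Type*} [CommRing O] [IsDomain O] [IsLocalRing O]
    [IsIntegrallyClosed O] [Field K]
    [Algebra O K] [IsFractionRing O K] [IsAlgClosed K] [Ring B] [Algebra O B]
    (b ε : B) (hb : IsIntegral O b) (hε0 : ε ≠ 0) (hε : ε * ε = ε) (hc : ε * b = b * ε)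
    (hmin : ∀ f : O[X], (ε * aeval b f) * (ε * aeval b f) = ε * aeval b f →
      ε * aeval b f = 0 ∨ ε * aeval b f = ε) :
    ∃ (c : O) (m : ℕ) (h : O[X]), h.map (IsLocalRing.residue O) = 0 ∧
      ε * (b - algebraMap O B c) ^ m = ε * aeval b h := by
  have hcf : ∀ f : O[X], ε * aeval b f = aeval b f * ε := by
    intro f
    induction f using Polynomial.induction_on' with
    | add p q hp hq => rw [map_add, mul_add, add_mul, hp, hq]
    | monomial n a =>
      rw [aeval_monomial, ← mul_assoc, ← Algebra.commutes, mul_assoc, mul_assoc]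
      congr 1
      exact (show Commute ε b from hc).pow_right n
  have hex : ∃ n, ∃ f : O[X], f.Monic ∧ ε * aeval b f = 0 ∧ f.natDegree = n := by
    obtain ⟨f, hf, h⟩ := hb
    exact ⟨_, f, hf, by rw [aeval_def, h, mul_zero], rfl⟩
  obtain ⟨f, hf, hf0, hfn⟩ := Nat.find_spec hex
  have hfmin : ∀ f' : O[X], f'.Monic → ε * aeval b f' = 0 → f.natDegree ≤ f'.natDegree := by
    intro f' h1 h2
    rw [hfn]
    exact Nat.find_min' hex ⟨f', h1, h2, rfl⟩
  obtain ⟨s, hs⟩ := monic_splits_int (K := K) f hf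
  have hs0 : s ≠ 0 := by
    rintro rfl
    simp only [Multiset.map_zero, Multiset.prod_zero] at hs
    rw [hs, map_one, mul_one] at hf0
    exact hε0 hf0
  obtain ⟨c, hcs⟩ := Multiset.exists_mem_of_ne_zero hs0
  set P : O → Prop := fun a => IsLocalRing.residue O a = IsLocalRing.residue O c with hP
  set s1 := s.filter P
  set s2 := s.filter (fun a => ¬ P a)
  have hs12 : s1 + s2 = s := Multiset.filter_add_not _ _
  set f1 := (s1.map (fun a => X - C a)).prod with hf1
  set f2 := (s2.map (fun a => X - C a)).prod with hf2
  have hff : f = f1 * f2 := by rw [hs, ← hs12, Multiset.map_add, Multiset.prod_add]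
  have hm1 : f1.Monic := monic_multiset_prod_of_monic _ _ fun a _ => monic_X_sub_C a
  have hm2 : f2.Monic := monic_multiset_prod_of_monic _ _ fun a _ => monic_X_sub_C a
  have hd1 : f1.natDegree = Multiset.card s1 := natDegree_multiset_prod_X_sub_C_eq_card s1
  have hd2 : f2.natDegree = Multiset.card s2 := natDegree_multiset_prod_X_sub_C_eq_card s2
  have hdf : f.natDegree = f1.natDegree + f2.natDegree := by rw [hff, hm1.natDegree_mul hm2]
  have hs1 : 0 < Multiset.card s1 := Multiset.card_pos_iff_exists_mem.mpr
    ⟨c, Multiset.mem_filter.mpr ⟨hcs, rfl⟩⟩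
  have hcop : IsCoprime f1 f2 := by
    apply coprime_aux
    intro a ha a' ha'
    have h1 : P a := (Multiset.mem_filter.mp ha).2
    have h2 : ¬ P a' := (Multiset.mem_filter.mp ha').2
    by_contra hu
    apply h2
    have := (IsLocalRing.residue_eq_zero_iff (a - a')).mpr ((IsLocalRing.mem_maximalIdeal _).mpr hu)
    rw [map_sub, sub_eq_zero] at this
    exact this.symm.trans h1
  obtain ⟨u, v, huv⟩ := hcop
  have hsplit : ∀ x : O[X], ε * aeval b (x * f) = 0 := by
    intro x
    rw [mul_comm, map_mul, ← mul_assoc, hf0, zero_mul]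
  have he : (ε * aeval b (u * f1)) * (ε * aeval b (u * f1)) = ε * aeval b (u * f1) := by
    have h1 : (ε * aeval b (u * f1)) * (ε * aeval b (u * f1))
        = ε * aeval b (u * f1 * (u * f1)) := by
      rw [map_mul (aeval b) (u * f1) (u * f1)]
      have hy := hcf (u * f1)
      calc (ε * aeval b (u * f1)) * (ε * aeval b (u * f1))
          = ε * (aeval b (u * f1) * ε) * aeval b (u * f1) := by simp only [mul_assoc]
        _ = (ε * ε) * (aeval b (u * f1) * aeval b (u * f1)) := by rw [← hy]; simp only [mul_assoc]
        _ = _ := by rw [hε]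
    have h2 : u * f1 * (u * f1) = u * f1 - (u * v) * f := by
      have : u * f1 = 1 - v * f2 := by rw [← huv]; ring
      calc u * f1 * (u * f1) = u * f1 * (1 - v * f2) := by rw [← this]
        _ = _ := by rw [hff]; ring
    rw [h1, h2, map_sub, mul_sub, hsplit, sub_zero]
  have hf2z : Multiset.card s2 = 0 := by
    rcases hmin _ he with h | h
    · have : ε * aeval b f1 = 0 := by
        have e1 : f1 = (u * f1) * f1 + v * f := by
          calc f1 = (u * f1 + v * f2) * f1 := by rw [huv, one_mul]
            _ = _ := by rw [hff]; ring
        rw [e1, map_add, mul_add, hsplit, add_zero, map_mul, ← mul_assoc, h, zero_mul]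
      have := hfmin f1 hm1 this
      omega
    · have : ε * aeval b f2 = 0 := by
        have e1 : f2 = u * f + (1 - u * f1) * f2 := by rw [hff]; ring
        rw [e1, map_add, mul_add, hsplit, zero_add, map_mul, ← mul_assoc, map_sub, mul_sub, h,
          map_one, mul_one, sub_self, zero_mul]
      have := hfmin f2 hm2 this
      omega
  have hs2 : s2 = 0 := Multiset.card_eq_zero.mp hf2z
  have hfe : f = f1 := by rw [hff, hf2, hs2]; simp
  refine ⟨c, Multiset.card s1, (X - C c) ^ (Multiset.card s1) - f, ?_, ?_⟩
  · rw [Polynomial.map_sub, hfe, hf1, Polynomial.map_multiset_prod, Multiset.map_map]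
    have : s1.map (fun a => Polynomial.map (IsLocalRing.residue O) (X - C a)) =
        s1.map (fun _ => X - C (IsLocalRing.residue O c)) := by
      apply Multiset.map_congr rfl
      intro a ha
      have h1 : P a := (Multiset.mem_filter.mp ha).2
      simp only [hP] at h1
      rw [Polynomial.map_sub, map_X, map_C, h1]
    simp only [Function.comp_def]
    rw [this]
    simp
  · rw [map_sub, mul_sub, hf0, sub_zero]
    simp
lemma commute_sub_end {k M : Type*} [CommRing k] [AddCommGroup M] [Module k M]
    (a b c : Module.End k M) (h1 : Commute a c) (h2 : Commute b c) : Commute (a - b) c :=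
  Commute.sub_left h1 h2

lemma exists_min_idem {K V : Type*} [Field K] [AddCommGroup V] [Module K V] [FiniteDimensional K V]
    [Nontrivial V] (A : Set (Module.End K V)) (h1 : 1 ∈ A) :
    ∃ ε ∈ A, ε ≠ 0 ∧ ε * ε = ε ∧ ∀ e ∈ A, e * e = e → ε * e = e → e * ε = e → e = 0 ∨ e = ε := by
  have hex : ∃ n, ∃ ε ∈ A, ε ≠ 0 ∧ ε * ε = ε ∧ Module.finrank K (LinearMap.range ε) = n :=
    ⟨_, 1, h1, one_ne_zero, one_mul 1, rfl⟩
  obtain ⟨ε, hεA, hε0, hε, hr⟩ := Nat.find_spec hex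
  refine ⟨ε, hεA, hε0, hε, fun e he hee h2 h3 => ?_⟩
  by_cases he0 : e = 0
  · exact Or.inl he0
  right
  have hle : Module.finrank K (LinearMap.range ε) ≤ Module.finrank K (LinearMap.range e) := by
    rw [hr]
    exact Nat.find_min' hex ⟨e, he, he0, hee, rfl⟩
  have hsub : LinearMap.range e ≤ LinearMap.range ε := by
    rintro _ ⟨v, rfl⟩
    refine ⟨e v, ?_⟩
    rw [← Module.End.mul_apply, h2]
  have heq := Submodule.eq_of_le_of_finrank_le hsub hle
  rw [← h3]
  ext v
  have : ε v ∈ LinearMap.range e := by rw [heq]; exact ⟨v, rfl⟩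
  obtain ⟨w, hw⟩ := this
  rw [Module.End.mul_apply, ← hw, ← Module.End.mul_apply, hee]

open Polynomial TensorProduct in
lemma reduction_main {G O K V : Type*} [Group G] [Fintype G] [CommRing O] [IsDomain O]
    [ValuationRing O] [Field K] [Algebra O K] [IsFractionRing O K] [IsAlgClosed K]
    [AddCommGroup V] [Module K V] [Module O V] [IsScalarTower O K V]
    [FiniteDimensional K V] [Nontrivial V]
    (p n : ℕ) [Fact p.Prime] [CharP (IsLocalRing.ResidueField O) p] (ρ : G →* Module.End K V)
    (hirr : ∀ U : Submodule K V, (∀ g, ∀ v ∈ U, ρ g v ∈ U) → U = ⊥ ∨ U = ⊤)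
    (P H N : Subgroup G) (x : G) (hx : P = Subgroup.zpowers x) (hcard : Nat.card P = p ^ n)
    (hHc : ∀ a ∈ H, ∀ b ∈ H, a * b = b * a) (hHp : ¬ p ∣ Nat.card H)
    (hHP : ∀ h ∈ H, ∀ u ∈ P, h * u * h⁻¹ ∈ P)
    (hN : ∀ t ∈ N, ∃ u ∈ P, ∃ h ∈ H, t = u * h) (hPN : P ≤ N)
    (hfree : ∀ t : G, t ∉ N → ∀ u ∈ P, t⁻¹ * u * t ∈ N → u = 1)
    (μ : P → O) (hμ : ∀ u, IsLocalRing.residue O (μ u) = 1)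
    (hσ : ∑ u : P, μ u • ρ u = 0) :
    Module.finrank K V < p ^ n := by
  have hinj : Function.Injective (algebraMap O K) := IsFractionRing.injective O K
  set Φ : MonoidAlgebra O G →ₐ[O] Module.End K V := MonoidAlgebra.lift O (Module.End K V) G ρ with hΦ
  have hΦg : ∀ g, Φ (MonoidAlgebra.of O G g) = ρ g := fun g => by
    rw [hΦ, MonoidAlgebra.lift_of]
  obtain ⟨ε', ⟨ε, rfl⟩, hε0, hεε, hmin⟩ := exists_min_idem (Set.range Φ) ⟨1, map_one Φ⟩
  obtain ⟨v0, hv0⟩ : ∃ v, Φ ε v ≠ 0 := by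
    by_contra h
    push Not at h
    exact hε0 (LinearMap.ext h)
  set w := Φ ε v0 with hw
  have hεw : Φ ε w = w := by rw [hw, ← Module.End.mul_apply, hεε]
  -- the lattice
  set τ : MonoidAlgebra O G →ₗ[O] V :=
    { toFun := fun r => Φ r w
      map_add' := fun r s => by rw [map_add, LinearMap.add_apply]
      map_smul' := fun c r => by rw [map_smul, LinearMap.smul_apply, RingHom.id_apply] } with hτ
  set W : Submodule O V := LinearMap.range τ with hW
  have hWρ : ∀ g, ∀ v ∈ W, ρ g v ∈ W := by
    rintro g _ ⟨r, rfl⟩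
    refine ⟨MonoidAlgebra.of O G g * r, ?_⟩
    change Φ (_ * r) w = ρ g (Φ r w)
    rw [map_mul, hΦg, Module.End.mul_apply]
  have : Module.Finite O (MonoidAlgebra O G) := inferInstance
  have hWfin : Module.Finite O W := Module.Finite.range τ
  have htf : Module.IsTorsionFree O V := by
    have : FaithfulSMul O K := inferInstance
    exact Module.IsTorsionFree.trans_faithfulSMul O K V
  have hWtf : Module.IsTorsionFree O W := inferInstance
  have hflat : Module.Flat O W := by
    rw [Module.Flat.flat_iff_torsion_eq_bot_of_isBezout, ← Submodule.isTorsionFree_iff_torsion_eq_bot]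
    exact hWtf
  have hfreeW : Module.Free O W := Module.free_of_flat_of_isLocalRing
  -- rank
  have hrank : Module.finrank O W = Module.finrank K V := by
    set bW := Module.Free.chooseBasis O W
    have hli : LinearIndependent O (fun i => (bW i : V)) :=
      bW.linearIndependent.map' W.subtype (Submodule.ker_subtype W)
    have hliK : LinearIndependent K (fun i => (bW i : V)) :=
      (LinearIndependent.iff_fractionRing O K).mp hli
    have hspan : ⊤ ≤ Submodule.span K (Set.range fun i => (bW i : V)) := by
      have hWle : ∀ v ∈ W, v ∈ Submodule.span K (Set.range fun i => (bW i : V)) := by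
        intro v hv
        have h1 : (⟨v, hv⟩ : W) ∈ Submodule.span O (Set.range bW) := by rw [bW.span_eq]; trivial
        have h2 : v ∈ (Submodule.span O (Set.range bW)).map W.subtype := ⟨_, h1, rfl⟩
        rw [Submodule.map_span, ← Set.range_comp] at h2
        exact Submodule.span_le_restrictScalars O K _ h2
      rcases hirr (Submodule.span K (Set.range fun i => (bW i : V))) (by
        intro g v hv
        induction hv using Submodule.span_induction with
        | mem x hx =>
          obtain ⟨i, rfl⟩ := hx
          exact hWle _ (hWρ g _ (bW i).2)
        | zero => rw [map_zero]; exact zero_mem _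
        | add x y _ _ hx hy => rw [map_add]; exact add_mem hx hy
        | smul c x _ hx => rw [map_smul]; exact Submodule.smul_mem _ _ hx) with h | h
      · exfalso
        have h3 := hWle w ⟨1, by change Φ 1 w = w; rw [map_one]; rfl⟩
        rw [h] at h3
        exact hv0 ((Submodule.mem_bot K).mp h3)
      · exact h.ge
    rw [Module.finrank_eq_card_basis bW, Module.finrank_eq_card_basis (Module.Basis.mk hliK hspan)]
  -- restricted action
  set ρW : G →* Module.End O W :=
    { toFun := fun g => ((ρ g).restrictScalars O).restrict (hWρ g)
      map_one' := by ext v; simp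
      map_mul' := fun g h => by
        ext v
        change ρ (g * h) (v : V) = ρ g (ρ h (v : V))
        rw [map_mul, Module.End.mul_apply] } with hρW
  have hρWa : ∀ g (v : W), ((ρW g v : W) : V) = ρ g v := fun g v => rfl
  set Ψ : MonoidAlgebra O G →ₐ[O] Module.End O W := MonoidAlgebra.lift O (Module.End O W) G ρW with hΨ
  have hΨΦ : ∀ r (v : W), ((Ψ r v : W) : V) = Φ r v := by
    intro r v
    induction r using MonoidAlgebra.induction_on with
    | of g => rw [hΨ, MonoidAlgebra.lift_of, hΦg, hρWa]
    | add a b ha hb => simp [ha, hb]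
    | smul c a ha => simp [ha]
  set k := IsLocalRing.ResidueField O with hk
  have : IsAlgClosed k := residue_algClosed (K := K)
  set θ := Module.End.baseChangeHom O k W with hθ
  set ρb : G →* Module.End k (k ⊗[O] W) := (θ : Module.End O W →* _).comp ρW with hρb
  have hfr : Module.finrank k (k ⊗[O] W) = Module.finrank K V := by
    rw [Module.finrank_baseChange, hrank]
  rw [← hfr]
  have hnt : Nontrivial (k ⊗[O] W) := by
    apply Module.nontrivial_of_finrank_pos (R := k)
    rw [hfr]; exact Module.finrank_pos
  set wW : W := ⟨w, 1, by change Φ 1 w = w; rw [map_one]; rfl⟩ with hwW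
  set wb : k ⊗[O] W := 1 ⊗ₜ wW with hwb
  have hΨb : ∀ r v, θ (Ψ r) ((1 : k) ⊗ₜ[O] v) = 1 ⊗ₜ (Ψ r v) := fun r v => rfl
  have hgen : ∀ y : k ⊗[O] W, ∃ r, y = θ (Ψ r) wb := by
    intro y
    induction y using TensorProduct.induction_on with
    | zero => exact ⟨0, by simp⟩
    | add a b ha hb =>
      obtain ⟨r, rfl⟩ := ha
      obtain ⟨s, rfl⟩ := hb
      exact ⟨r + s, by simp⟩
    | tmul c v =>
      obtain ⟨c, rfl⟩ := IsLocalRing.residue_surjective c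
      obtain ⟨_, r, rfl⟩ := v
      refine ⟨c • r, ?_⟩
      have h1 : Ψ (c • r) wW = c • ⟨τ r, r, rfl⟩ := by
        apply Subtype.ext
        rw [hΨΦ, map_smul]; rfl
      rw [hwb, hΨb, h1, ← TensorProduct.smul_tmul]
      congr 1
      rw [Algebra.smul_def, mul_one]; rfl
  refine modular_core p n ρb P H N x hx hcard hHc hHp hHP hN hPN hfree ?_ ?_
  · have h0 : ∑ u : P, μ u • ρW u = 0 := by
      ext v
      have := LinearMap.congr_fun hσ (v : V)
      simpa [LinearMap.sum_apply, hρWa] using this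
    have h1 := congrArg θ h0
    rw [map_sum, map_zero] at h1
    rw [← h1]
    refine Finset.sum_congr rfl fun u _ => ?_
    rw [map_smul]
    have : μ u • θ (ρW u) = (IsLocalRing.residue O (μ u)) • θ (ρW u) := by
      rw [← algebraMap_smul k (μ u)]; rfl
    rw [this, hμ, one_smul]; rfl
  · intro a ha
    have haΨ : ∀ r, a * θ (Ψ r) = θ (Ψ r) * a := by
      intro r
      induction r using MonoidAlgebra.induction_on with
      | of g => rw [hΨ, MonoidAlgebra.lift_of]; exact ha g
      | add x y hx hy => simp only [map_add, mul_add, add_mul, hx, hy]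
      | smul c x hx => simp only [map_smul, mul_smul_comm, smul_mul_assoc, hx]
    obtain ⟨r, hr⟩ := hgen (a wb)
    set b := ε * r * ε with hb
    have hεwb : θ (Ψ ε) wb = wb := by
      rw [hwb, hΨb]
      congr 1
      exact Subtype.ext (by rw [hΨΦ]; exact hεw)
    have hab : a wb = θ (Ψ b) wb := by
      rw [hb, map_mul, map_mul, map_mul, map_mul, Module.End.mul_apply, Module.End.mul_apply, hεwb,
        ← hr, ← Module.End.mul_apply, ← haΨ, Module.End.mul_apply, hεwb]
    have hεb : Φ ε * Φ b = Φ b := by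
      rw [hb, map_mul, map_mul, ← mul_assoc, ← mul_assoc, hεε]
    have hbε : Φ b * Φ ε = Φ b := by
      rw [hb, map_mul, map_mul, mul_assoc, hεε]
    have hint : IsIntegral O (Φ b) := (Algebra.IsIntegral.isIntegral (R := O) b).map Φ
    have hcom : ∀ f : O[X], Φ ε * aeval (Φ b) f = aeval (Φ b) f * Φ ε := by
      intro f
      have hc : Commute (Φ ε) (Φ b) := hεb.trans hbε.symm
      induction f using Polynomial.induction_on' with
      | add p q hp hq => rw [map_add, mul_add, add_mul, hp, hq]
      | monomial n a =>
        rw [aeval_monomial, ← mul_assoc, ← Algebra.commutes, mul_assoc, mul_assoc]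
        congr 1
        exact hc.pow_right n
    obtain ⟨c, m, h, hh, hcm⟩ := local_of_min (K := K) (Φ b) (Φ ε) hint hε0 hεε
      (hεb.trans hbε.symm) (by
        intro f hf
        refine hmin _ ⟨ε * aeval b f, by rw [map_mul, aeval_algHom_apply]⟩ hf ?_ ?_
        · rw [← mul_assoc, hεε]
        · rw [mul_assoc, ← hcom, ← mul_assoc, hεε])
    refine ⟨IsLocalRing.residue O c, m, ?_⟩
    set cb := algebraMap k (Module.End k (k ⊗[O] W)) (IsLocalRing.residue O c) with hcb
    have hcb' : θ (Ψ (algebraMap O _ c)) = cb := by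
      rw [AlgHom.commutes, AlgHom.commutes, IsScalarTower.algebraMap_apply O k]; rfl
    have hpow : ∀ m, ((a - cb) ^ m) wb = ((θ (Ψ b) - cb) ^ m) wb := by
      intro m
      induction m with
      | zero => rfl
      | succ m ih =>
        have hcm : Commute (a - cb) ((θ (Ψ b) - cb) ^ m) := by
          apply Commute.pow_right
          rw [← hcb', ← map_sub θ, ← map_sub Ψ]
          have h1 : Commute a (θ (Ψ (b - algebraMap O _ c))) := haΨ _
          have h2 : Commute (θ (Ψ (algebraMap O _ c))) (θ (Ψ (b - algebraMap O _ c))) := by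
            rw [hcb']; exact Algebra.commutes _ _
          exact commute_sub_end _ _ _ h1 h2
        rw [pow_succ' (a - cb), Module.End.mul_apply, ih, ← Module.End.mul_apply, hcm.eq,
          Module.End.mul_apply, pow_succ, Module.End.mul_apply]
        congr 1
        rw [LinearMap.sub_apply, LinearMap.sub_apply, hab]
    have hzero : ((a - cb) ^ m) wb = 0 := by
      rw [hpow, ← hcb', ← map_sub θ, ← map_sub Ψ, ← map_pow θ, ← map_pow Ψ]
      have e1 : Ψ ((b - algebraMap O _ c) ^ m) wW = Ψ (aeval b h) wW := by
        apply Subtype.ext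
        rw [hΨΦ, hΨΦ]
        have hcm' : Φ ε * Φ ((b - algebraMap O _ c) ^ m) = Φ ε * aeval (Φ b) h := by
          rw [← hcm, map_pow, map_sub, AlgHom.commutes]
        have hcc : Φ ε * Φ ((b - algebraMap O _ c) ^ m) = Φ ((b - algebraMap O _ c) ^ m) * Φ ε := by
          have := hcom ((X - C c) ^ m)
          rw [aeval_algHom_apply] at this
          simpa using this
        change Φ _ w = Φ _ w
        have key : ∀ y, Φ y w = (Φ y * Φ ε) w := fun y => by rw [Module.End.mul_apply, hεw]
        rw [key, key (aeval b h), ← hcc, hcm', hcom, aeval_algHom_apply]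
      rw [hwb, hΨb, e1, ← hΨb, ← hwb, ← aeval_algHom_apply, ← aeval_algHom_apply]
      have e2 : aeval (θ (Ψ b)) h = aeval (θ (Ψ b)) (h.map (IsLocalRing.residue O)) := by
        have := aeval_map_algebraMap k (θ (Ψ b)) h
        exact this.symm
      rw [e2, hh, map_zero, LinearMap.zero_apply]
    refine LinearMap.ext fun y => ?_
    obtain ⟨s, rfl⟩ := hgen y
    have hcs : Commute (a - cb) (θ (Ψ s)) := by
      have h1 : Commute a (θ (Ψ s)) := haΨ _
      have h2 : Commute cb (θ (Ψ s)) := Algebra.commutes _ _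
      exact commute_sub_end _ _ _ h1 h2
    have hcs' := (hcs.pow_left m).eq
    change ((a - cb) ^ m) _ = 0
    rw [← Module.End.mul_apply, hcs', Module.End.mul_apply, hzero, map_zero]

lemma exists_valuation_char (p : ℕ) [Fact p.Prime] :
    ∃ B : ValuationSubring ℂ, CharP (IsLocalRing.ResidueField B) p := by
  have hp : p.Prime := Fact.out
  set A : Subring ℂ := (Int.castRingHom ℂ).range with hA
  set I : Ideal A := Ideal.span {(p : A)} with hI
  have hne : I ≠ ⊤ := by
    intro h
    rw [hI, Ideal.span_singleton_eq_top, isUnit_iff_exists_inv] at h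
    obtain ⟨⟨b, ⟨m, rfl⟩⟩, hb⟩ := h
    have h2 : ((p : ℤ) : ℂ) * (m : ℂ) = 1 := by
      have := congrArg Subtype.val hb
      simpa using this
    have h3 : (p : ℤ) * m = 1 := by exact_mod_cast h2
    have h4 : (p : ℤ) ∣ 1 := ⟨m, h3.symm⟩
    have h5 : p ∣ 1 := by exact_mod_cast h4
    exact hp.one_lt.ne' (Nat.dvd_one.mp h5)
  obtain ⟨B, hAB, hB⟩ := Ideal.image_subset_nonunits_valuationSubring I hne
  refine ⟨B, (CharP.charP_iff_prime_eq_zero hp).2 ?_⟩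
  have h1 : (p : ℂ) ∈ B.nonunits := hB ⟨(p : A), Ideal.subset_span rfl, by simp⟩
  have h2 : ((p : B) : ℂ) ∈ B.nonunits := by simpa using h1
  rw [ValuationSubring.coe_mem_nonunits_iff] at h2
  have h3 := (IsLocalRing.residue_eq_zero_iff (p : B)).2 h2
  simpa using h3

lemma simple_irr {G : Type} [Group G] (V : FDRep ℂ G) (hV : CategoryTheory.Simple V) :
    Nontrivial V ∧ ∀ U : Submodule ℂ V, (∀ g, ∀ v ∈ U, V.ρ g v ∈ U) → U = ⊥ ∨ U = ⊤ := by
  constructor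
  · by_contra h
    rw [not_nontrivial_iff_subsingleton] at h
    apply CategoryTheory.id_nonzero V
    ext v
    exact Subsingleton.elim _ _
  · intro U hU
    let r : Representation ℂ G U :=
      { toFun := fun g => (V.ρ g).restrict (hU g)
        map_one' := by ext v; simp
        map_mul' := by intro a b; ext v; simp }
    let f : FDRep.of r ⟶ V := ⟨CategoryTheory.InducedCategory.homMk (ModuleCat.ofHom U.subtype),
      fun g => by ext1; rfl⟩
    have hf : ∀ u : U, f.hom.hom.hom u = (u : V) := fun u => rfl
    have : CategoryTheory.Mono f := by
      apply CategoryTheory.ConcreteCategory.mono_of_injective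
      intro a b hab
      exact Subtype.ext hab
    by_cases h0 : f = 0
    · left
      rw [eq_bot_iff]
      intro v hv
      have := hf ⟨v, hv⟩
      rw [h0] at this
      exact this.symm
    · right
      have hiso := (CategoryTheory.Simple.mono_isIso_iff_nonzero f).2 h0
      rw [eq_top_iff]
      intro v _
      have h1 := (FDRep.isoToLinearEquiv (CategoryTheory.asIso f)).surjective v
      obtain ⟨u, hu⟩ := h1
      rw [← hu]
      exact u.2

lemma schur_scalar {G V : Type} [Group G] [AddCommGroup V] [Module ℂ V] [FiniteDimensional ℂ V]
    [Nontrivial V] (ρ : G →* Module.End ℂ V)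
    (hirr : ∀ U : Submodule ℂ V, (∀ g, ∀ v ∈ U, ρ g v ∈ U) → U = ⊥ ∨ U = ⊤)
    (z : G) (hz : z ∈ Subgroup.center G) : ∃ c : ℂ, ρ z = c • 1 := by
  obtain ⟨c, hc⟩ := Module.End.exists_eigenvalue (ρ z)
  refine ⟨c, ?_⟩
  have hinv : ∀ g, ∀ v ∈ Module.End.eigenspace (ρ z) c, ρ g v ∈ Module.End.eigenspace (ρ z) c := by
    intro g v hv
    rw [Module.End.mem_eigenspace_iff] at hv ⊢
    rw [← Module.End.mul_apply, ← map_mul, ← Subgroup.mem_center_iff.mp hz g, map_mul,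
      Module.End.mul_apply, hv, map_smul]
  rcases hirr (Module.End.eigenspace (ρ z) c) hinv with h | h
  · exact absurd h hc
  · ext v
    have : v ∈ Module.End.eigenspace (ρ z) c := by rw [h]; trivial
    simpa using Module.End.mem_eigenspace_iff.mp this

lemma trace_pos {V : Type} [AddCommGroup V] [Module ℂ V] [FiniteDimensional ℂ V]
    (σ : Module.End ℂ V) (q : ℕ) (hq : 0 < q) (hσ : σ * σ = (q : ℂ) • σ) (h0 : σ ≠ 0) :
    ∃ m : ℕ, 0 < m ∧ LinearMap.trace ℂ V σ = m := by
  have hq' : (q : ℂ) ≠ 0 := by exact_mod_cast hq.ne'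
  have he : IsIdempotentElem ((q : ℂ)⁻¹ • σ) := by
    unfold IsIdempotentElem
    rw [smul_mul_smul_comm, hσ, smul_smul]
    congr 1
    field_simp
  have h1 := (LinearMap.IsIdempotentElem.isProj_range _ he).trace
  have h2 := LinearMap.IsIdempotentElem.trace_eq_zero_iff he
  have hne : ((q : ℂ)⁻¹ • σ) ≠ 0 := smul_ne_zero (inv_ne_zero hq') h0
  set r := Module.finrank ℂ (LinearMap.range ((q : ℂ)⁻¹ • σ)) with hr
  have hr0 : r ≠ 0 := by
    intro h
    apply hne
    rw [← h2, h1, h]; simp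
  refine ⟨q * r, Nat.mul_pos hq (Nat.pos_of_ne_zero hr0), ?_⟩
  rw [map_smul, smul_eq_mul] at h1
  push_cast
  rw [← h1]
  field_simp
lemma complex_case {G V : Type} [Group G] [Fintype G]
    [AddCommGroup V] [Module ℂ V] [FiniteDimensional ℂ V] [Nontrivial V]
    (p n : ℕ) [Fact p.Prime] (ρ : G →* Module.End ℂ V)
    (hirr : ∀ U : Submodule ℂ V, (∀ g, ∀ v ∈ U, ρ g v ∈ U) → U = ⊥ ∨ U = ⊤)
    (P H N : Subgroup G) (x : G) (hx : P = Subgroup.zpowers x) (hcard : Nat.card P = p ^ n)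
    (hHc : ∀ a ∈ H, ∀ b ∈ H, a * b = b * a) (hHp : ¬ p ∣ Nat.card H)
    (hHP : ∀ h ∈ H, ∀ u ∈ P, h * u * h⁻¹ ∈ P)
    (hN : ∀ t ∈ N, ∃ u ∈ P, ∃ h ∈ H, t = u * h) (hPN : P ≤ N)
    (hfree : ∀ t : G, t ∉ N → ∀ u ∈ P, t⁻¹ * u * t ∈ N → u = 1)
    (μ : P → ℂ) (hμ : ∀ u, μ u ^ (p ^ n) = 1)
    (hσ : ∑ u : P, μ u • ρ u = 0) :
    Module.finrank ℂ V < p ^ n := by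
  have hp : p.Prime := Fact.out
  obtain ⟨B, hB⟩ := exists_valuation_char p
  letI : Module B V := Module.compHom V (algebraMap B ℂ)
  haveI : IsScalarTower B ℂ V := ⟨fun a b v => by
    change (a • b) • v = (algebraMap B ℂ a) • (b • v)
    rw [Algebra.smul_def, mul_smul]⟩
  have hmem : ∀ u, ∃ b : B, algebraMap B ℂ b = μ u := by
    intro u
    have hint : IsIntegral B (μ u) := by
      apply IsIntegral.of_pow (pow_pos hp.pos n)
      rw [hμ u]
      exact isIntegral_one
    exact IsIntegrallyClosed.isIntegral_iff.mp hint
  choose ν hν using hmem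
  have hinj : Function.Injective (algebraMap B ℂ) := IsFractionRing.injective B ℂ
  refine reduction_main (O := B) p n ρ hirr P H N x hx hcard hHc hHp hHP hN hPN hfree ν ?_ ?_
  · intro u
    have h1 : (ν u) ^ (p ^ n) = 1 := hinj (by rw [map_pow, hν, hμ, map_one])
    have h2 := congrArg (IsLocalRing.residue B) h1
    rw [map_pow, map_one] at h2
    rw [← sub_eq_zero]
    have h3 : (IsLocalRing.residue B (ν u) - 1) ^ (p ^ n) = 0 := by
      rw [sub_pow_char_pow, h2, one_pow, sub_self]
    exact pow_eq_zero_iff (pow_pos hp.pos n).ne' |>.mp h3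
  · rw [← hσ]
    refine Finset.sum_congr rfl fun u _ => ?_
    rw [← hν u, algebraMap_smul]

/-- Sum over the central part and the Sylow part. -/
lemma sum_center_mul {G : Type} [Group G] [Fintype G] (Z P : Subgroup G)
    (hZP : ∀ z ∈ Z, z ∈ P → z = 1) (f : G → ℂ)
    (h0 : ∀ x : G, (¬ ∃ z ∈ Z, ∃ u ∈ P, x = z * u) → f x = 0) :
    ∑ x : G, f x = ∑ z : Z, ∑ u : P, f (z * u) := by
  rw [← Fintype.sum_prod_type' (f := fun (z : Z) (u : P) => f (z * u))]
  symm
  apply Fintype.sum_of_injective (fun w : Z × P => (w.1 : G) * (w.2 : G))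
  · rintro ⟨⟨z, hz⟩, ⟨u, hu⟩⟩ ⟨⟨z', hz'⟩, ⟨u', hu'⟩⟩ h
    simp only at h
    have h1 : z'⁻¹ * z = u' * u⁻¹ := by
      rw [inv_mul_eq_iff_eq_mul, ← mul_assoc, ← h, mul_assoc, mul_inv_cancel, mul_one]
    have h2 : z'⁻¹ * z = 1 := hZP _ (Z.mul_mem (Z.inv_mem hz') hz)
      (h1 ▸ P.mul_mem hu' (P.inv_mem hu))
    have h3 : z = z' := (inv_mul_eq_one.mp h2).symm
    have h4 : u = u' := by rw [h3] at h; exact mul_left_cancel h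
    simp [h3, h4]
  · intro y hy
    apply h0
    rintro ⟨z, hz, u, hu, rfl⟩
    exact hy ⟨(⟨z, hz⟩, ⟨u, hu⟩), rfl⟩
  · intro w; rfl

lemma induced_inner {G : Type} [Group G] [Fintype G] (c : ℂ) (ψ φ : G → ℂ)
    (hφ : ∀ y x, φ (y * x * y⁻¹) = φ x) :
    charInner G (fun x => c * ∑ y : G, ψ (y * x * y⁻¹)) φ =
      c * ∑ x : G, ψ x * (starRingEnd ℂ) (φ x) := by
  unfold charInner
  have hG : (Fintype.card G : ℂ) ≠ 0 := by exact_mod_cast Fintype.card_ne_zero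
  have h1 : ∀ y : G, ∑ x : G, ψ (y * x * y⁻¹) * (starRingEnd ℂ) (φ x) =
      ∑ x : G, ψ x * (starRingEnd ℂ) (φ x) := by
    intro y
    refine Fintype.sum_equiv (MulAut.conj y).toEquiv _ _ fun x => ?_
    simp [hφ]
  simp_rw [mul_assoc c, ← Finset.mul_sum, Finset.sum_mul]
  rw [Finset.sum_comm]
  simp_rw [h1]
  simp only [Finset.sum_const, Finset.card_univ, nsmul_eq_mul]
  field_simp

lemma final_pos {G : Type} [Group G] [Fintype G] (V : FDRep ℂ G) [Nontrivial V]
    (hirr : ∀ U : Submodule ℂ V, (∀ g, ∀ v ∈ U, V.ρ g v ∈ U) → U = ⊥ ∨ U = ⊤)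
    (P C : Subgroup G) (hZP : ∀ z ∈ Subgroup.center G, z ∈ P → z = 1)
    (ζ lam : G → ℂ) (hζ1 : ζ 1 = 1)
    (hres : ∀ z ∈ Subgroup.center G, V.character z = V.character 1 * ζ z)
    (h1 : lam 1 = 1)
    (hmul : ∀ u ∈ P, ∀ u' ∈ P, lam (u * u') = lam u * lam u')
    (hσ : ∑ u : P, (lam u)⁻¹ • V.ρ u ≠ 0)
    (ψ : G → ℂ)
    (hψ0 : ∀ x : G, (¬ ∃ z ∈ Subgroup.center G, ∃ u ∈ P, x = z * u) → ψ x = 0)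
    (hψ : ∀ z ∈ Subgroup.center G, ∀ u ∈ P, ψ (z * u) = ζ z * lam u) :
    0 < (charInner G (fun x => (Fintype.card C : ℂ)⁻¹ * ∑ y : G, ψ (y * x * y⁻¹))
      V.character).re := by
  have hchar : ∀ t, V.character t = LinearMap.trace ℂ V (V.ρ t) := fun t => rfl
  have hdim : V.character 1 ≠ 0 := by
    rw [FDRep.char_one]
    exact_mod_cast (Module.finrank_pos (R := ℂ) (M := V)).ne'
  have hzu : ∀ z ∈ Subgroup.center G, ∀ u, V.character (z * u) = ζ z * V.character u := by
    intro z hz u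
    obtain ⟨c, hc⟩ := schur_scalar V.ρ hirr z hz
    have h2 : ∀ t, V.character (z * t) = c * V.character t := by
      intro t
      rw [hchar, hchar, map_mul, hc, smul_mul_assoc, one_mul, map_smul, smul_eq_mul]
    have h3 : c = ζ z := by
      have h4 := h2 1
      rw [mul_one, hres z hz, mul_comm] at h4
      exact (mul_right_cancel₀ hdim h4).symm
    rw [h2, h3]
  -- powers of lam
  have hpow : ∀ (u : G) (_ : u ∈ P) (k : ℕ), lam (u ^ k) = lam u ^ k := by
    intro u hu k
    induction k with
    | zero => simp [h1]
    | succ k ih => rw [pow_succ, hmul _ (P.pow_mem hu k) _ hu, ih, pow_succ]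
  have hone : ∀ u ∈ P, lam u ^ Fintype.card G = 1 := by
    intro u hu
    rw [← hpow u hu, pow_card_eq_one, h1]
  have hne : ∀ u ∈ P, lam u ≠ 0 := by
    intro u hu h
    have := hone u hu
    rw [h, zero_pow Fintype.card_ne_zero] at this
    exact zero_ne_one this
  have hconj : ∀ u ∈ P, (starRingEnd ℂ) ((lam u)⁻¹) = lam u := by
    intro u hu
    have hn : ‖lam u‖ = 1 := Complex.norm_eq_one_of_pow_eq_one (hone u hu) Fintype.card_ne_zero
    rw [Complex.inv_def, Complex.normSq_eq_norm_sq, hn]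
    simp
  set σ : Module.End ℂ V := ∑ u : P, (lam u)⁻¹ • V.ρ u with hσdef
  have hmulσ : ∀ w : P, ((lam w)⁻¹ • V.ρ w) * σ = σ := by
    intro w
    rw [hσdef, Finset.mul_sum]
    refine Fintype.sum_equiv (Equiv.mulLeft w) _ _ fun u => ?_
    rw [smul_mul_smul_comm, ← map_mul]
    simp only [Equiv.coe_mulLeft, Subgroup.coe_mul]
    rw [hmul _ w.2 _ u.2, mul_inv]
  have hσσ : σ * σ = (Fintype.card P : ℂ) • σ := by
    conv_lhs => rw [hσdef, Finset.sum_mul]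
    rw [← hσdef, Finset.sum_congr rfl (fun w _ => hmulσ w)]
    simp [Finset.sum_const, Nat.cast_smul_eq_nsmul]
  obtain ⟨m, hm, htr⟩ := trace_pos σ (Fintype.card P) Fintype.card_pos hσσ hσ
  have hsumP : ∑ u : P, lam u * (starRingEnd ℂ) (V.character u) = m := by
    have h2 := congrArg (starRingEnd ℂ) htr
    rw [hσdef, map_sum, map_sum, Complex.conj_natCast] at h2
    rw [← h2]
    refine Finset.sum_congr rfl fun u _ => ?_
    rw [map_smul, smul_eq_mul, map_mul, hconj _ u.2, hchar]
  rw [induced_inner _ _ _ (fun y x => FDRep.char_conj V x y),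
    sum_center_mul (Subgroup.center G) P hZP (fun x => ψ x * (starRingEnd ℂ) (V.character x))
      (fun x hx => by rw [hψ0 x hx, zero_mul])]
  have h5 : ∀ z : Subgroup.center G, ∑ u : P, ψ (z * u) * (starRingEnd ℂ) (V.character (z * u)) =
      ((Complex.normSq (ζ z) * m : ℝ) : ℂ) := by
    intro z
    push_cast
    rw [← hsumP, Finset.mul_sum, ← Complex.mul_conj]
    refine Finset.sum_congr rfl fun u _ => ?_
    rw [hψ _ z.2 _ u.2, hzu _ z.2, map_mul]
    ring
  rw [Finset.sum_congr rfl (fun z _ => h5 z), ← Complex.ofReal_sum, ← Complex.ofReal_natCast,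
    ← Complex.ofReal_inv, ← Complex.ofReal_mul, Complex.ofReal_re]
  apply mul_pos
  · apply inv_pos.mpr
    exact_mod_cast Fintype.card_pos
  · refine Finset.sum_pos' (fun z _ => ?_) ⟨1, ?_, ?_⟩
    · exact mul_nonneg (Complex.normSq_nonneg _) (Nat.cast_nonneg _)
    · apply @Finset.mem_univ _ (_)
    · rw [Subgroup.coe_one, hζ1]
      simpa using hm

/-- Let `G` be a finite group with cyclic Sylow `p`-subgroup `P`, with `p`
coprime to `|Z(G)|`, and suppose `C_G(g) = Z(G)·P` for an element `g ∈ P` of order `p`.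
Let `φ` be a complex irreducible character of `G` with `φ|_{Z(G)} = ζ·Id` for a linear
character `ζ` of `Z(G)`.  Then either `φ(1) < |P|`, or `φ` is a constituent of the
induced character `(ζ × λ)^G` from `Z(G)·P` for every irreducible (linear) character
`λ` of the cyclic group `P`. -/
theorem stmt_6 {G : Type} [Group G] [Fintype G]
    (p : ℕ) (hp : p.Prime) [Fact p.Prime] (P : Sylow p G)
    (hcyc : IsCyclic ↥(P : Subgroup G))
    (hcop : ¬ p ∣ Fintype.card ↥(Subgroup.center G))
    (g : G) (hg : g ∈ (P : Subgroup G)) (hgo : orderOf g = p)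
    (hcent : Subgroup.centralizer ({g} : Set G) = Subgroup.center G ⊔ (P : Subgroup G))
    (φ : G → ℂ) (hφ : IsIrrChar G φ)
    (ζ : G → ℂ) (hζ1 : ζ 1 = 1)
    (hζmul : ∀ z ∈ Subgroup.center G, ∀ z' ∈ Subgroup.center G, ζ (z * z') = ζ z * ζ z')
    (hres : ∀ z ∈ Subgroup.center G, φ z = φ 1 * ζ z)
    (d : ℕ) (hd : φ 1 = (d : ℂ)) :
    d < Fintype.card ↥(P : Subgroup G) ∨
      ∀ lam : G → ℂ, lam 1 = 1 →
        (∀ u ∈ (P : Subgroup G), ∀ u' ∈ (P : Subgroup G), lam (u * u') = lam u * lam u') →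
        ∀ ψ : G → ℂ,
          (∀ x : G, (¬ ∃ z ∈ Subgroup.center G, ∃ u ∈ (P : Subgroup G), x = z * u) → ψ x = 0) →
          (∀ z ∈ Subgroup.center G, ∀ u ∈ (P : Subgroup G), ψ (z * u) = ζ z * lam u) →
          0 < (charInner G
            (fun x => (Fintype.card ↥(Subgroup.center G ⊔ (P : Subgroup G)) : ℂ)⁻¹ *
              ∑ y : G, ψ (y * x * y⁻¹)) φ).re := by
  obtain ⟨V, hV, rfl⟩ := hφ
  obtain ⟨hnt, hirr⟩ := simple_irr V hV
  obtain ⟨n, x, H, N, hx, hcard, hHc, hHp, hHP, hN, hPN, hfree⟩ :=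
    group_data p P hcyc hcop g hg hgo hcent
  have hPpow : ∀ u ∈ (P : Subgroup G), u ^ (p ^ n) = 1 := by
    intro u hu
    have := pow_card_eq_one' (x := (⟨u, hu⟩ : (P : Subgroup G)))
    rw [hcard] at this
    exact congrArg Subtype.val this
  have hd' : d = Module.finrank ℂ V := by
    rw [FDRep.char_one] at hd
    exact_mod_cast hd.symm
  by_cases hlt : d < Fintype.card ↥(P : Subgroup G)
  · exact Or.inl hlt
  right
  intro lam h1 hmul ψ hψ0 hψ
  refine final_pos V hirr (P : Subgroup G) _ ?_ ζ lam hζ1 hres h1 hmul ?_ ψ hψ0 hψ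
  · intro z hz hzP
    exact center_coprime p hcop hz n (hPpow z hzP)
  · intro hσ
    apply hlt
    rw [hd', ← Nat.card_eq_fintype_card, hcard]
    refine complex_case p n V.ρ hirr (P : Subgroup G) H N x hx hcard hHc hHp hHP hN hPN hfree
      (fun u => (lam u)⁻¹) ?_ hσ
    intro u
    have hpow : ∀ k : ℕ, lam ((u : G) ^ k) = lam u ^ k := by
      intro k
      induction k with
      | zero => simp [h1]
      | succ k ih => rw [pow_succ, hmul _ (Subgroup.pow_mem _ u.2 k) _ u.2, ih, pow_succ]
    rw [inv_pow, ← hpow, hPpow _ u.2, h1, inv_one]
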